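/- For every β > 0 there exists ᾱ > 0 such that for every step size α with 0 < α < ᾱ and αβ < 1 and every initial point x(0) ∈ ℝ^{np}, the FRSD iterate sequence converges linearly to the consensus optimum: there exist c > 0 and λ ∈ (0,1) such that ‖x(k) − 1_n ⊗ x*‖ ≤ c λ^k for all k ≥ 0. -/

import Mathlib

open Matrix Filter
open scoped Kronecker

noncomputable section

/-- Euclidean norm on `ι → ℝ`. -/
def eucNorm {ι : Type*} [Fintype ι] (z : ι → ℝ) : ℝ := Real.sqrt (∑ i, z i ^ 2)

/-- Spectral norm (operator 2-norm) of a square real matrix. -/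
def specNorm {ι : Type*} [Fintype ι] (A : Matrix ι ι ℝ) : ℝ :=
  sSup {c : ℝ | ∃ z : ι → ℝ, eucNorm z ≤ 1 ∧ c = eucNorm (A.mulVec z)}

/-- Matrix norm induced by a vector norm `N`: `sup_{z ≠ 0} N (A z) / N z`. -/
def opNorm {ι : Type*} [Fintype ι] (N : (ι → ℝ) → ℝ) (A : Matrix ι ι ℝ) : ℝ :=
  sSup {c : ℝ | ∃ z : ι → ℝ, z ≠ 0 ∧ c = N (A.mulVec z) / N z}

/-- `g` is the gradient of `f : ℝ^p → ℝ`. -/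
def IsGradient {p : ℕ} (f : (Fin p → ℝ) → ℝ) (g : (Fin p → ℝ) → Fin p → ℝ) : Prop :=
  ∀ x, HasFDerivAt f (∑ j, g x j • (ContinuousLinearMap.proj j : (Fin p → ℝ) →L[ℝ] ℝ)) x

/-- `R = R̄ ⊗ I_p`. -/
def RK (n p : ℕ) (Rb : Matrix (Fin n) (Fin n) ℝ) :
    Matrix (Fin n × Fin p) (Fin n × Fin p) ℝ :=
  Rb ⊗ₖ (1 : Matrix (Fin p) (Fin p) ℝ)

/-- `V_∞ = (1_n π^T) ⊗ I_p`. -/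
def VinfK (n p : ℕ) (π : Fin n → ℝ) :
    Matrix (Fin n × Fin p) (Fin n × Fin p) ℝ :=
  (Matrix.of (fun _ j => π j) : Matrix (Fin n) (Fin n) ℝ) ⊗ₖ (1 : Matrix (Fin p) (Fin p) ℝ)

/-- `V(k) = R̄^k ⊗ I_p`. -/
def VK (n p : ℕ) (Rb : Matrix (Fin n) (Fin n) ℝ) (k : ℕ) :
    Matrix (Fin n × Fin p) (Fin n × Fin p) ℝ :=
  (Rb ^ k) ⊗ₖ (1 : Matrix (Fin p) (Fin p) ℝ)

/-- `Ṽ(k)⁻¹ = diag(((R̄^k)_{11})⁻¹, …, ((R̄^k)_{nn})⁻¹) ⊗ I_p`. -/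
def VtinvK (n p : ℕ) (Rb : Matrix (Fin n) (Fin n) ℝ) (k : ℕ) :
    Matrix (Fin n × Fin p) (Fin n × Fin p) ℝ :=
  Matrix.diagonal (fun q => ((Rb ^ k) q.1 q.1)⁻¹)

/-- `∇f(z) = (∇f_1(z_1), …, ∇f_n(z_n))` block-wise. -/
def gradf {n p : ℕ} (g : Fin n → (Fin p → ℝ) → Fin p → ℝ) (z : Fin n × Fin p → ℝ) :
    Fin n × Fin p → ℝ :=
  fun q => g q.1 (fun j => z (q.1, j)) q.2

/-- `x*_vec = 1_n ⊗ x*`. -/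
def starVec (n p : ℕ) (xstar : Fin p → ℝ) : Fin n × Fin p → ℝ := fun q => xstar q.2

end


/-! ### Scalar recursions -/

lemma frsd_rec (V : ℕ → ℝ) (hV : ∀ k, 0 ≤ V k) (q C ρ : ℝ) (hq0 : 0 ≤ q) (hq : q < 1)
    (hρ0 : 0 ≤ ρ) (hρ : ρ < 1) (hC : 0 ≤ C)
    (h : ∀ k, V (k + 1) ≤ (q + C * ρ ^ k) * V k + C * ρ ^ k) :
    ∃ c : ℝ, 0 < c ∧ ∃ lam : ℝ, 0 < lam ∧ lam < 1 ∧ ∀ k, V k ≤ c * lam ^ k := by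
  obtain ⟨lam, hl1, hl2⟩ := exists_between (max_lt hq hρ)
  have hql : q < lam := lt_of_le_of_lt (le_max_left _ _) hl1
  have hρl : ρ < lam := lt_of_le_of_lt (le_max_right _ _) hl1
  have hl0 : 0 < lam := lt_of_le_of_lt hq0 hql
  set δ := (lam - q) / 2 with hδ
  have hδ0 : 0 < δ := by rw [hδ]; linarith
  have ht : Tendsto (fun k : ℕ => C * ρ ^ k) atTop (nhds 0) := by
    simpa using (tendsto_pow_atTop_nhds_zero_of_lt_one hρ0 hρ).const_mul C
  obtain ⟨K, hK⟩ := Filter.eventually_atTop.1 (ht.eventually (gt_mem_nhds hδ0))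
  set c := C / δ + ∑ k ∈ Finset.range (K + 1), V k / lam ^ k + 1 with hc
  have hS : 0 ≤ ∑ k ∈ Finset.range (K + 1), V k / lam ^ k :=
    Finset.sum_nonneg fun k _ => div_nonneg (hV k) (pow_pos hl0 k).le
  have hCd : 0 ≤ C / δ := div_nonneg hC hδ0.le
  have hc0 : 0 < c := by rw [hc]; linarith
  have hcδ : C ≤ c * δ := by
    have h1 : C / δ ≤ c := by rw [hc]; linarith
    exact (div_le_iff₀ hδ0).1 h1
  have hsmall : ∀ k, k ≤ K → V k ≤ c * lam ^ k := by
    intro k hk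
    have h1 : V k / lam ^ k ≤ ∑ k ∈ Finset.range (K + 1), V k / lam ^ k :=
      Finset.single_le_sum (f := fun k => V k / lam ^ k)
        (fun k _ => div_nonneg (hV k) (pow_pos hl0 k).le)
        (Finset.mem_range.2 (by omega))
    have h2 : V k / lam ^ k ≤ c := by rw [hc]; linarith
    exact (div_le_iff₀ (pow_pos hl0 k)).1 h2
  have hbig : ∀ m, V (K + m) ≤ c * lam ^ (K + m) := by
    intro m
    induction m with
    | zero => exact hsmall K le_rfl
    | succ m ih =>
      have h1 := h (K + m)
      have h2 : C * ρ ^ (K + m) < δ := hK (K + m) (by omega)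
      have h3 : C * ρ ^ (K + m) ≤ C * lam ^ (K + m) :=
        mul_le_mul_of_nonneg_left (pow_le_pow_left₀ hρ0 hρl.le _) hC
      have h4 : 0 < lam ^ (K + m) := pow_pos hl0 _
      have h5 : (q + C * ρ ^ (K + m)) * V (K + m) ≤ (lam - δ) * V (K + m) :=
        mul_le_mul_of_nonneg_right (by rw [hδ] at *; linarith) (hV _)
      have h6 : (lam - δ) * V (K + m) ≤ (lam - δ) * (c * lam ^ (K + m)) :=
        mul_le_mul_of_nonneg_left ih (by rw [hδ]; linarith)
      have h7 : C * lam ^ (K + m) ≤ c * δ * lam ^ (K + m) :=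
        mul_le_mul_of_nonneg_right hcδ h4.le
      rw [← add_assoc, pow_succ]
      nlinarith
  refine ⟨c, hc0, lam, hl0, hl2, fun k => ?_⟩
  rcases le_total k K with hk | hk
  · exact hsmall k hk
  · obtain ⟨m, rfl⟩ := Nat.exists_eq_add_of_le hk
    exact hbig m

lemma frsd_lyap (β σ m C ρ : ℝ) (hβ : 0 < β) (hσ0 : 0 ≤ σ) (hσ : σ < 1) (hm : 0 < m)
    (hC : 0 < C) (hρ0 : 0 ≤ ρ) (hρ : ρ < 1) :
    ∃ αbar : ℝ, 0 < αbar ∧ ∀ α, 0 < α → α < αbar → α * β < 1 →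
      ∀ e w a : ℕ → ℝ, (∀ k, 0 ≤ e k) → (∀ k, 0 ≤ w k) → (∀ k, 0 ≤ a k) →
      (∀ k, e (k + 1) ≤ (σ + α * C) * e k + α * C * w k + α * C * a k
        + C * ρ ^ k * (1 + e k + a k)) →
      (∀ k, w (k + 1) ≤ (1 - α * β) * w k + α * C * e k + α * C * a k
        + C * ρ ^ k * (1 + e k + a k)) →
      (∀ k, a (k + 1) ≤ (1 - α * m) * a k + α * C * e k + C * ρ ^ k * (1 + e k + a k)) →
      ∃ c : ℝ, 0 < c ∧ ∃ lam : ℝ, 0 < lam ∧ lam < 1 ∧ ∀ k, e k + a k ≤ c * lam ^ k := by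
  obtain ⟨K, hK0, hK⟩ : ∃ K : ℝ, 0 < K ∧ K * C = β / 2 :=
    ⟨β / 2 / C, by positivity, by field_simp⟩
  obtain ⟨M, hM0, hM⟩ : ∃ M : ℝ, 0 < M ∧ M * m = 2 * (C + K * C) :=
    ⟨2 * (C + K * C) / m, by positivity, by field_simp⟩
  obtain ⟨T, hT0, hT⟩ : ∃ T : ℝ, 0 < T ∧ T = K * C + C + M * C := ⟨_, by positivity, rfl⟩
  have hσ' : 0 < 1 - σ := by linarith
  refine ⟨min (K * (1 - σ) / 2 / T) (1 / m), by positivity, ?_⟩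
  intro α hα hαb hαβ e w a he hw ha hre hrw hra
  have hα1 : α * T < K * (1 - σ) / 2 :=
    (lt_div_iff₀ hT0).1 (lt_of_lt_of_le hαb (min_le_left _ _))
  have hα2 : α * m < 1 := (lt_div_iff₀ hm).1 (lt_of_lt_of_le hαb (min_le_right _ _))
  obtain ⟨q, hq⟩ : ∃ q : ℝ, q = max (max (1 - α * m / 2) (1 - α * β / 2)) ((1 + σ) / 2) :=
    ⟨_, rfl⟩
  have hq1 : 1 - α * m / 2 ≤ q := by rw [hq]; simp
  have hq2 : 1 - α * β / 2 ≤ q := by rw [hq]; simp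
  have hq3 : (1 + σ) / 2 ≤ q := by rw [hq]; simp
  have hαm : 0 < α * m := by positivity
  have hαβ0 : 0 < α * β := by positivity
  have hqlt : q < 1 := by
    rw [hq]; refine max_lt (max_lt ?_ ?_) ?_ <;> linarith
  have hq0 : 0 ≤ q := by linarith
  obtain ⟨B, hB0, hB1, hB2⟩ : ∃ B : ℝ, 0 < B ∧ 1 ≤ B * K ∧ 1 ≤ B * M := by
    refine ⟨1 / K + 1 / M, by positivity, ?_, ?_⟩
    · have : (1 / K + 1 / M) * K = 1 + K / M := by field_simp
      rw [this]; have : 0 < K / M := by positivity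
      linarith
    · have : (1 / K + 1 / M) * M = 1 + M / K := by field_simp; ring
      rw [this]; have : 0 < M / K := by positivity
      linarith
  have hea : ∀ k, e k + a k ≤ B * (M * a k + w k + K * e k) := by
    intro k
    have h1 := mul_le_mul_of_nonneg_right hB1 (he k)
    have h2 := mul_le_mul_of_nonneg_right hB2 (ha k)
    have h3 := mul_nonneg hB0.le (hw k)
    nlinarith
  obtain ⟨c, hc0, lam, hl0, hl1, hV⟩ := frsd_rec (fun k => M * a k + w k + K * e k)
    (fun k => by have := he k; have := hw k; have := ha k; positivity) q
    ((M + 1 + K) * C * (1 + B)) ρ hq0 hqlt hρ0 hρ (by positivity) (by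
      intro k
      have E := mul_le_mul_of_nonneg_left (hre k) hK0.le
      have W := hrw k
      have A := mul_le_mul_of_nonneg_left (hra k) hM0.le
      have hN : 0 ≤ C * ρ ^ k := by positivity
      obtain ⟨N, hNN⟩ : ∃ N, N = C * ρ ^ k := ⟨_, rfl⟩
      rw [← hNN] at E W A hN
      have e0 := he k
      have w0 := hw k
      have a0 := ha k
      have c1 : (M * (1 - α * m) + α * C + K * (α * C)) * a k ≤ q * (M * a k) := by
        have : M * (1 - α * m) + α * C + K * (α * C) = (1 - α * m / 2) * M := by
          linear_combination (-α / 2) * hM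
        rw [this, mul_assoc]
        exact mul_le_mul_of_nonneg_right hq1 (by positivity)
      have c2 : ((1 - α * β) + K * (α * C)) * w k ≤ q * w k := by
        have : (1 - α * β) + K * (α * C) = 1 - α * β / 2 := by
          linear_combination α * hK
        rw [this]
        exact mul_le_mul_of_nonneg_right hq2 w0
      have c3 : (K * (σ + α * C) + α * C + M * (α * C)) * e k ≤ q * (K * e k) := by
        have : K * (σ + α * C) + α * C + M * (α * C) ≤ (1 + σ) / 2 * K := by
          have : K * (σ + α * C) + α * C + M * (α * C) = K * σ + α * T := by rw [hT]; ring
          rw [this]; linarith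
        calc _ ≤ (1 + σ) / 2 * K * e k := mul_le_mul_of_nonneg_right this e0
          _ = (1 + σ) / 2 * (K * e k) := by ring
          _ ≤ _ := mul_le_mul_of_nonneg_right hq3 (by positivity)
      have hs : (M + 1 + K) * N * (1 + e k + a k)
          ≤ (M + 1 + K) * N * (1 + B) * (M * a k + w k + K * e k) + (M + 1 + K) * N * (1 + B) := by
        have hp : 0 ≤ (M + 1 + K) * N := by positivity
        have : 1 + e k + a k ≤ (1 + B) * (M * a k + w k + K * e k) + (1 + B) := by
          have := hea k
          have h2 : 0 ≤ M * a k + w k + K * e k := by positivity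
          nlinarith
        calc _ ≤ (M + 1 + K) * N * ((1 + B) * (M * a k + w k + K * e k) + (1 + B)) :=
              mul_le_mul_of_nonneg_left this hp
          _ = _ := by ring
      have hr : (q + (M + 1 + K) * C * (1 + B) * ρ ^ k) * (M * a k + w k + K * e k)
          + (M + 1 + K) * C * (1 + B) * ρ ^ k
          = q * (M * a k) + q * w k + q * (K * e k)
          + ((M + 1 + K) * N * (1 + B) * (M * a k + w k + K * e k) + (M + 1 + K) * N * (1 + B)) := by
        rw [hNN]; ring
      show M * a (k+1) + w (k+1) + K * e (k+1) ≤ _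
      rw [hr]
      linarith)
  refine ⟨B * c, by positivity, lam, hl0, hl1, fun k => ?_⟩
  have := mul_le_mul_of_nonneg_left (hV k) hB0.le
  have := hea k

  linarith [mul_assoc B c (lam ^ k)]

/-! ### Norms -/

lemma eucNorm_eq {ι : Type*} [Fintype ι] (z : ι → ℝ) :
    eucNorm z = ‖(WithLp.toLp 2 z : EuclideanSpace ℝ ι)‖ := by
  rw [EuclideanSpace.norm_eq]
  simp [eucNorm]

lemma eucNorm_nonneg {ι : Type*} [Fintype ι] (z : ι → ℝ) : 0 ≤ eucNorm z := Real.sqrt_nonneg _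

lemma eucNorm_add {ι : Type*} [Fintype ι] (z z' : ι → ℝ) :
    eucNorm (z + z') ≤ eucNorm z + eucNorm z' := by
  simp only [eucNorm_eq, WithLp.toLp_add]; exact norm_add_le _ _

lemma eucNorm_sub {ι : Type*} [Fintype ι] (z z' : ι → ℝ) :
    eucNorm (z - z') ≤ eucNorm z + eucNorm z' := by
  simp only [eucNorm_eq, WithLp.toLp_sub]; exact norm_sub_le _ _

lemma eucNorm_smul {ι : Type*} [Fintype ι] (c : ℝ) (z : ι → ℝ) :
    eucNorm (c • z) = |c| * eucNorm z := by
  simp only [eucNorm_eq, WithLp.toLp_smul, norm_smul, Real.norm_eq_abs]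

lemma eucNorm_sum {ι κ : Type*} [Fintype ι] (s : Finset κ) (z : κ → ι → ℝ) :
    eucNorm (∑ i ∈ s, z i) ≤ ∑ i ∈ s, eucNorm (z i) := by
  simp only [eucNorm_eq, WithLp.toLp_sum]; exact norm_sum_le _ _

lemma eucNorm_sq {ι : Type*} [Fintype ι] (z : ι → ℝ) : eucNorm z ^ 2 = ∑ i, z i ^ 2 :=
  Real.sq_sqrt (Finset.sum_nonneg fun _ _ => sq_nonneg _)

/-- weighted norm -/
noncomputable def wN {n p : ℕ} (π : Fin n → ℝ) (z : Fin n × Fin p → ℝ) : ℝ :=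
  Real.sqrt (∑ q, π q.1 * z q ^ 2)

lemma wN_eq {n p : ℕ} (π : Fin n → ℝ) (hπ : ∀ i, 0 < π i) (z : Fin n × Fin p → ℝ) :
    wN π z = eucNorm (fun q => Real.sqrt (π q.1) * z q) := by
  simp only [wN, eucNorm, mul_pow, Real.sq_sqrt (hπ _).le]

lemma wN_nonneg {n p : ℕ} (π : Fin n → ℝ) (z : Fin n × Fin p → ℝ) : 0 ≤ wN π z :=
  Real.sqrt_nonneg _

lemma wN_add {n p : ℕ} (π : Fin n → ℝ) (hπ : ∀ i, 0 < π i) (z z' : Fin n × Fin p → ℝ) :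
    wN π (z + z') ≤ wN π z + wN π z' := by
  simp only [wN_eq π hπ]
  convert eucNorm_add _ _ using 2
  ext q; simp [mul_add]

lemma wN_smul {n p : ℕ} (π : Fin n → ℝ) (hπ : ∀ i, 0 < π i) (c : ℝ) (z : Fin n × Fin p → ℝ) :
    wN π (c • z) = |c| * wN π z := by
  simp only [wN_eq π hπ]
  rw [← eucNorm_smul]
  congr 1
  ext q; simp; ring

lemma wN_le {n p : ℕ} (π : Fin n → ℝ) (hπ1 : ∀ i, π i ≤ 1) (z : Fin n × Fin p → ℝ) :
    wN π z ≤ eucNorm z := by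
  apply Real.sqrt_le_sqrt
  apply Finset.sum_le_sum
  intro q _
  nlinarith [hπ1 q.1, sq_nonneg (z q)]

lemma le_wN {n : ℕ} (p : ℕ) (π : Fin n → ℝ) (hπ : ∀ i, 0 < π i) :
    ∃ c : ℝ, 0 < c ∧ ∀ z : Fin n × Fin p → ℝ, eucNorm z ≤ c * wN π z := by
  have h0 : 0 ≤ ∑ i, (π i)⁻¹ := Finset.sum_nonneg fun i _ => (inv_pos.2 (hπ i)).le
  refine ⟨Real.sqrt (1 + ∑ i, (π i)⁻¹), Real.sqrt_pos.2 (by linarith), fun z => ?_⟩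
  rw [wN, eucNorm, ← Real.sqrt_mul (by linarith)]
  apply Real.sqrt_le_sqrt
  rw [Finset.mul_sum]
  apply Finset.sum_le_sum
  intro q _
  have h1 : (π q.1)⁻¹ ≤ ∑ i, (π i)⁻¹ :=
    Finset.single_le_sum (f := fun i => (π i)⁻¹) (fun i _ => (inv_pos.2 (hπ i)).le)
      (Finset.mem_univ _)
  have h2 : 1 ≤ (1 + ∑ i, (π i)⁻¹) * π q.1 := by
    calc (1 : ℝ) = (π q.1)⁻¹ * π q.1 := (inv_mul_cancel₀ (hπ q.1).ne').symm
      _ ≤ _ := mul_le_mul_of_nonneg_right (by linarith) (hπ _).le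
  nlinarith [sq_nonneg (z q)]

/-- block -/
noncomputable def blk {n p : ℕ} (z : Fin n × Fin p → ℝ) (i : Fin n) : Fin p → ℝ := fun j => z (i, j)

lemma blk_le {n p : ℕ} (z : Fin n × Fin p → ℝ) (i : Fin n) : eucNorm (blk z i) ≤ eucNorm z := by
  apply Real.sqrt_le_sqrt
  rw [Fintype.sum_prod_type]
  exact Finset.single_le_sum (f := fun i => ∑ j, z (i, j) ^ 2)
    (fun i _ => Finset.sum_nonneg fun _ _ => sq_nonneg _) (Finset.mem_univ i)

lemma le_blk {n p : ℕ} (z : Fin n × Fin p → ℝ) : eucNorm z ≤ ∑ i, eucNorm (blk z i) := by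
  have h0 : 0 ≤ ∑ i, eucNorm (blk z i) := Finset.sum_nonneg fun i _ => eucNorm_nonneg _
  apply Real.sqrt_le_iff.2 ⟨h0, ?_⟩
  rw [Fintype.sum_prod_type]
  have : ∀ i, ∑ j, z (i, j) ^ 2 = eucNorm (blk z i) ^ 2 := fun i => (eucNorm_sq _).symm
  simp only [this]
  exact Finset.sum_sq_le_sq_sum_of_nonneg fun i _ => eucNorm_nonneg _

/-- weighted mean -/
noncomputable def mn {n p : ℕ} (π : Fin n → ℝ) (z : Fin n × Fin p → ℝ) : Fin p → ℝ :=
  fun j => ∑ i, π i * z (i, j)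

/-- deviation from the mean -/
noncomputable def dev {n p : ℕ} (π : Fin n → ℝ) (z : Fin n × Fin p → ℝ) : Fin n × Fin p → ℝ :=
  fun q => z q - mn π z q.2

lemma mn_le {n p : ℕ} (π : Fin n → ℝ) (hπ : ∀ i, 0 < π i) (hπ1 : ∀ i, π i ≤ 1)
    (z : Fin n × Fin p → ℝ) : eucNorm (mn π z) ≤ ∑ i, eucNorm (blk z i) := by
  have : mn π z = ∑ i, π i • blk z i := by
    ext j; simp [mn, blk]
  rw [this]
  refine (eucNorm_sum _ _).trans (Finset.sum_le_sum fun i _ => ?_)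
  rw [eucNorm_smul, abs_of_pos (hπ i)]
  nlinarith [hπ1 i, eucNorm_nonneg (blk z i)]

lemma dev_le {n p : ℕ} (π : Fin n → ℝ) (hπ : ∀ i, 0 < π i) (hπ1 : ∀ i, π i ≤ 1)
    (z : Fin n × Fin p → ℝ) : wN π (dev π z) ≤ (1 + n) * ∑ i, eucNorm (blk z i) := by
  refine (wN_le π hπ1 _).trans ((le_blk _).trans ?_)
  have : ∀ i, eucNorm (blk (dev π z) i) ≤ eucNorm (blk z i) + ∑ i, eucNorm (blk z i) := by
    intro i
    have h : blk (dev π z) i = blk z i - mn π z := by ext j; simp [blk, dev]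
    rw [h]
    exact (eucNorm_sub _ _).trans (by gcongr; exact mn_le π hπ hπ1 z)
  refine (Finset.sum_le_sum fun i _ => this i).trans ?_
  rw [Finset.sum_add_distrib]
  simp
  linarith

/-! ### The stochastic matrix -/

lemma pow_nonneg_entry {n : ℕ} (Rb : Matrix (Fin n) (Fin n) ℝ) (hnonneg : ∀ i j, 0 ≤ Rb i j)
    (k : ℕ) : ∀ i j, 0 ≤ (Rb ^ k) i j := by
  induction k with
  | zero => intro i j; simp [Matrix.one_apply]; split_ifs <;> norm_num
  | succ k ih =>
    intro i j
    rw [pow_succ, Matrix.mul_apply]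
    exact Finset.sum_nonneg fun l _ => mul_nonneg (ih i l) (hnonneg l j)

lemma pow_diag_pos {n : ℕ} (Rb : Matrix (Fin n) (Fin n) ℝ) (hnonneg : ∀ i j, 0 ≤ Rb i j)
    (hdiag : ∀ i, 0 < Rb i i) (k : ℕ) (i : Fin n) : 0 < (Rb ^ k) i i := by
  induction k with
  | zero => simp
  | succ k ih =>
    rw [pow_succ, Matrix.mul_apply]
    exact lt_of_lt_of_le (mul_pos ih (hdiag i)) (Finset.single_le_sum
      (f := fun l => (Rb ^ k) i l * Rb l i)
      (fun l _ => mul_nonneg (pow_nonneg_entry Rb hnonneg k i l) (hnonneg l i))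
      (Finset.mem_univ i))

lemma stat_sum {n : ℕ} (Rb : Matrix (Fin n) (Fin n) ℝ) (π : Fin n → ℝ)
    (hπstat : Matrix.vecMul π Rb = π) (z : Fin n → ℝ) :
    ∑ i, π i * ∑ j, Rb i j * z j = ∑ j, π j * z j := by
  have : ∀ j, ∑ i, π i * Rb i j = π j := fun j => by
    conv_rhs => rw [← hπstat]
    simp [Matrix.vecMul, dotProduct]
  simp only [Finset.mul_sum]
  rw [Finset.sum_comm]
  refine Finset.sum_congr rfl fun j _ => ?_
  rw [← this j, Finset.sum_mul]
  exact Finset.sum_congr rfl fun i _ => by ring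

lemma var_id {n : ℕ} (Rb : Matrix (Fin n) (Fin n) ℝ) (hrow : ∀ i, ∑ j, Rb i j = 1)
    (π : Fin n → ℝ) (hπstat : Matrix.vecMul π Rb = π) (z : Fin n → ℝ) :
    ∑ i, π i * z i ^ 2 - ∑ i, π i * (∑ j, Rb i j * z j) ^ 2
      = ∑ i, ∑ j, π i * (Rb i j * (z j - ∑ l, Rb i l * z l) ^ 2) := by
  rw [← stat_sum Rb π hπstat (fun j => z j ^ 2), ← Finset.sum_sub_distrib]
  refine Finset.sum_congr rfl fun i _ => ?_
  rw [← Finset.mul_sum, ← mul_sub]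
  congr 1
  obtain ⟨m, hm⟩ : ∃ m, m = ∑ l, Rb i l * z l := ⟨_, rfl⟩
  rw [← hm]
  have : ∀ j, Rb i j * (z j - m) ^ 2 = Rb i j * z j ^ 2 - 2 * m * (Rb i j * z j) + m ^ 2 * Rb i j :=
    fun j => by ring
  simp only [this, Finset.sum_add_distrib, Finset.sum_sub_distrib, ← Finset.mul_sum, hrow, ← hm]
  ring

lemma contr_lt {n : ℕ} (Rb : Matrix (Fin n) (Fin n) ℝ)
    (hnonneg : ∀ i j, 0 ≤ Rb i j) (hrow : ∀ i, ∑ j, Rb i j = 1)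
    (hdiag : ∀ i, 0 < Rb i i) (hirr : ∀ i j, ∃ k : ℕ, 0 < (Rb ^ k) i j)
    (π : Fin n → ℝ) (hπpos : ∀ i, 0 < π i) (hπsum : ∑ i, π i = 1)
    (hπstat : Matrix.vecMul π Rb = π) (z : Fin n → ℝ) (hz : ∑ i, π i * z i = 0)
    (hz1 : ∑ i, π i * z i ^ 2 = 1) : ∑ i, π i * (∑ j, Rb i j * z j) ^ 2 < 1 := by
  by_contra hcon
  have hv := var_id Rb hrow π hπstat z
  have hnn : ∀ i j, 0 ≤ π i * (Rb i j * (z j - ∑ l, Rb i l * z l) ^ 2) := fun i j =>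
    mul_nonneg (hπpos i).le (mul_nonneg (hnonneg i j) (sq_nonneg _))
  have h0 : ∑ i, ∑ j, π i * (Rb i j * (z j - ∑ l, Rb i l * z l) ^ 2) = 0 :=
    le_antisymm (by rw [← hv]; linarith)
      (Finset.sum_nonneg fun i _ => Finset.sum_nonneg fun j _ => hnn i j)
  have h1 : ∀ i j, 0 < Rb i j → z j = ∑ l, Rb i l * z l := by
    intro i j hij
    have h2 := (Finset.sum_eq_zero_iff_of_nonneg
      (fun i _ => Finset.sum_nonneg fun j _ => hnn i j)).1 h0 i (Finset.mem_univ i)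
    have h3 := (Finset.sum_eq_zero_iff_of_nonneg (fun j _ => hnn i j)).1 h2 j (Finset.mem_univ j)
    have h4 := (mul_eq_zero.1 h3).resolve_left (hπpos i).ne'
    have h5 := (mul_eq_zero.1 h4).resolve_left hij.ne'
    have h6 := pow_eq_zero_iff (two_ne_zero) |>.1 h5
    linarith
  have h2 : ∀ i j, 0 < Rb i j → z i = z j := fun i j hij => by
    rw [h1 i j hij, ← h1 i i (hdiag i)]
  have h3 : ∀ k i j, 0 < (Rb ^ k) i j → z i = z j := by
    intro k
    induction k with
    | zero =>
      intro i j hij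
      by_cases h : i = j
      · rw [h]
      · simp [Matrix.one_apply, h] at hij
    | succ k ih =>
      intro i j hij
      rw [pow_succ, Matrix.mul_apply] at hij
      obtain ⟨l, _, hl⟩ := Finset.exists_lt_of_sum_lt (s := Finset.univ) (f := fun _ => (0:ℝ))
        (g := fun l => (Rb ^ k) i l * Rb l j) (by simpa using hij)
      have ha := pow_nonneg_entry Rb hnonneg k i l
      have hb := hnonneg l j
      have ha' : 0 < (Rb ^ k) i l := lt_of_le_of_ne ha (by rintro h; simp [← h] at hl)
      have hb' : 0 < Rb l j := lt_of_le_of_ne hb (by rintro h; simp [← h] at hl)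
      exact (ih i l ha').trans (h2 l j hb')
  have h4 : ∀ i j, z i = z j := fun i j => by
    obtain ⟨k, hk⟩ := hirr i j
    exact h3 k i j hk
  have h5 : ∀ i, z i = 0 := by
    intro i
    have : ∑ l, π l * z l = ∑ l, π l * z i := Finset.sum_congr rfl fun l _ => by rw [h4 l i]
    rw [← Finset.sum_mul, hπsum, hz] at this
    linarith
  simp [h5] at hz1

lemma contr {n : ℕ} (Rb : Matrix (Fin n) (Fin n) ℝ)
    (hnonneg : ∀ i j, 0 ≤ Rb i j) (hrow : ∀ i, ∑ j, Rb i j = 1)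
    (hdiag : ∀ i, 0 < Rb i i) (hirr : ∀ i j, ∃ k : ℕ, 0 < (Rb ^ k) i j)
    (π : Fin n → ℝ) (hπpos : ∀ i, 0 < π i) (hπsum : ∑ i, π i = 1)
    (hπstat : Matrix.vecMul π Rb = π) :
    ∃ s : ℝ, 0 ≤ s ∧ s < 1 ∧ ∀ z : Fin n → ℝ, ∑ i, π i * z i = 0 →
      ∑ i, π i * (∑ j, Rb i j * z j) ^ 2 ≤ s ^ 2 * ∑ i, π i * z i ^ 2 := by
  suffices h : ∃ t : ℝ, 0 ≤ t ∧ t < 1 ∧ ∀ z : Fin n → ℝ, ∑ i, π i * z i = 0 →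
      ∑ i, π i * z i ^ 2 = 1 → ∑ i, π i * (∑ j, Rb i j * z j) ^ 2 ≤ t by
    obtain ⟨t, ht0, ht1, ht⟩ := h
    refine ⟨Real.sqrt t, Real.sqrt_nonneg _, ?_, ?_⟩
    · rw [Real.sqrt_lt' one_pos]; simpa using ht1
    intro z hz
    rw [Real.sq_sqrt ht0]
    have hq0 : 0 ≤ ∑ i, π i * z i ^ 2 :=
      Finset.sum_nonneg fun i _ => mul_nonneg (hπpos i).le (sq_nonneg _)
    rcases hq0.eq_or_lt with hq | hq
    · have : ∀ i, z i = 0 := by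
        intro i
        have h1 := (Finset.sum_eq_zero_iff_of_nonneg
          (fun i _ => mul_nonneg (hπpos i).le (sq_nonneg (z i)))).1 hq.symm i (Finset.mem_univ i)
        simpa [(hπpos i).ne'] using h1
      simp [this]
    · obtain ⟨r, hr⟩ : ∃ r, r = Real.sqrt (∑ i, π i * z i ^ 2) := ⟨_, rfl⟩
      have hr0 : 0 < r := by rw [hr]; exact Real.sqrt_pos.2 hq
      have hr2 : r ^ 2 = ∑ i, π i * z i ^ 2 := by rw [hr]; exact Real.sq_sqrt hq0
      have h1 := ht (fun i => r⁻¹ * z i) (by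
        have : ∀ i, π i * (r⁻¹ * z i) = r⁻¹ * (π i * z i) := fun i => by ring
        simp only [this, ← Finset.mul_sum, hz, mul_zero]) (by
        have : ∀ i, π i * (r⁻¹ * z i) ^ 2 = r⁻¹ ^ 2 * (π i * z i ^ 2) := fun i => by ring
        simp only [this, ← Finset.mul_sum, ← hr2]
        field_simp)
      have h2 : ∀ i j, Rb i j * (r⁻¹ * z j) = r⁻¹ * (Rb i j * z j) := fun i j => by ring
      have h3 : ∀ i (c : ℝ), π i * (r⁻¹ * c) ^ 2 = r⁻¹ ^ 2 * (π i * c ^ 2) := fun i c => by ring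
      simp only [h2, ← Finset.mul_sum, h3] at h1
      rw [← hr2]
      rw [inv_pow, inv_mul_le_iff₀ (by positivity)] at h1
      linarith
  have hcl : IsCompact {z : Fin n → ℝ | ∑ i, π i * z i = 0 ∧ ∑ i, π i * z i ^ 2 = 1} := by
    apply Metric.isCompact_of_isClosed_isBounded
    · exact (isClosed_eq (by fun_prop) continuous_const).inter
        (isClosed_eq (by fun_prop) continuous_const)
    · refine (Metric.isBounded_closedBall (x := (0 : Fin n → ℝ))
        (r := ∑ i, (1 + (π i)⁻¹))).subset ?_
      rintro z ⟨_, hz⟩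
      have hnn : ∀ i, 0 ≤ (π i)⁻¹ := fun i => (inv_pos.2 (hπpos i)).le
      rw [mem_closedBall_zero_iff, pi_norm_le_iff_of_nonneg
        (Finset.sum_nonneg fun i _ => by linarith [hnn i])]
      intro i
      have h1 : π i * z i ^ 2 ≤ 1 := by
        rw [← hz]
        exact Finset.single_le_sum (f := fun i => π i * z i ^ 2)
          (fun i _ => mul_nonneg (hπpos i).le (sq_nonneg _)) (Finset.mem_univ i)
      have h2 : z i ^ 2 ≤ (π i)⁻¹ := by
        rw [← one_div, le_div_iff₀ (hπpos i)]; linarith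
      have h3 : 1 + (π i)⁻¹ ≤ ∑ i, (1 + (π i)⁻¹) :=
        Finset.single_le_sum (f := fun i => 1 + (π i)⁻¹)
          (fun i _ => by linarith [hnn i]) (Finset.mem_univ i)
      refine le_trans ?_ h3
      rw [Real.norm_eq_abs]
      nlinarith [sq_abs (z i), sq_nonneg (|z i| - 1), hnn i]
  rcases Set.eq_empty_or_nonempty {z : Fin n → ℝ | ∑ i, π i * z i = 0 ∧ ∑ i, π i * z i ^ 2 = 1}
    with hE | hE
  · refine ⟨0, le_rfl, one_pos, fun z h1 h2 => ?_⟩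
    have : z ∈ (∅ : Set (Fin n → ℝ)) := hE ▸ ⟨h1, h2⟩
    exact this.elim
  · obtain ⟨z0, hz0, hmax⟩ := hcl.exists_isMaxOn hE
      (f := fun z => ∑ i, π i * (∑ j, Rb i j * z j) ^ 2) (by fun_prop)
    exact ⟨_, Finset.sum_nonneg fun i _ => mul_nonneg (hπpos i).le (sq_nonneg _),
      contr_lt Rb hnonneg hrow hdiag hirr π hπpos hπsum hπstat z0 hz0.1 hz0.2,
      fun z h1 h2 => hmax ⟨h1, h2⟩⟩

/-! ### Linear algebra of the mean, the deviation and the mixing operator -/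

/-- action of `R̄ ⊗ I` -/
noncomputable def Rop {n p : ℕ} (Rb : Matrix (Fin n) (Fin n) ℝ) (z : Fin n × Fin p → ℝ) :
    Fin n × Fin p → ℝ :=
  fun q => ∑ l, Rb q.1 l * z (l, q.2)

lemma RK_mulVec {n p : ℕ} (Rb : Matrix (Fin n) (Fin n) ℝ) (z : Fin n × Fin p → ℝ) :
    (RK n p Rb).mulVec z = Rop Rb z := by
  ext ⟨i, j⟩
  simp [RK, Rop, Matrix.mulVec, dotProduct, Fintype.sum_prod_type, Matrix.kroneckerMap_apply,
    Matrix.one_apply]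

lemma mn_add {n p : ℕ} (π : Fin n → ℝ) (z z' : Fin n × Fin p → ℝ) :
    mn π (z + z') = mn π z + mn π z' := by
  ext j; simp [mn, mul_add, Finset.sum_add_distrib]

lemma mn_sub {n p : ℕ} (π : Fin n → ℝ) (z z' : Fin n × Fin p → ℝ) :
    mn π (z - z') = mn π z - mn π z' := by
  ext j; simp [mn, mul_sub, Finset.sum_sub_distrib]

lemma mn_smul {n p : ℕ} (π : Fin n → ℝ) (c : ℝ) (z : Fin n × Fin p → ℝ) :
    mn π (c • z) = c • mn π z := by
  ext j; simp [mn, Finset.mul_sum, mul_left_comm]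

lemma dev_add {n p : ℕ} (π : Fin n → ℝ) (z z' : Fin n × Fin p → ℝ) :
    dev π (z + z') = dev π z + dev π z' := by
  ext j; simp [dev, mn_add]; ring

lemma dev_sub {n p : ℕ} (π : Fin n → ℝ) (z z' : Fin n × Fin p → ℝ) :
    dev π (z - z') = dev π z - dev π z' := by
  ext j; simp [dev, mn_sub]; ring

lemma dev_smul {n p : ℕ} (π : Fin n → ℝ) (c : ℝ) (z : Fin n × Fin p → ℝ) :
    dev π (c • z) = c • dev π z := by
  ext j; simp [dev, mn_smul]; ring

lemma dev_self {n p : ℕ} (π : Fin n → ℝ) (z : Fin n × Fin p → ℝ) (h : mn π z = 0) :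
    dev π z = z := by
  ext j; simp [dev, h]

lemma mn_dev {n p : ℕ} (π : Fin n → ℝ) (hπsum : ∑ i, π i = 1) (z : Fin n × Fin p → ℝ) :
    mn π (dev π z) = 0 := by
  ext j
  have : mn π (dev π z) j = ∑ i, (π i * z (i, j) - π i * mn π z j) := by
    simp only [mn, dev, mul_sub]
  rw [this, Finset.sum_sub_distrib, ← Finset.sum_mul, hπsum]
  simp [mn]

lemma mn_Rop {n p : ℕ} (Rb : Matrix (Fin n) (Fin n) ℝ) (π : Fin n → ℝ)
    (hπstat : Matrix.vecMul π Rb = π) (z : Fin n × Fin p → ℝ) :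
    mn π (Rop Rb z) = mn π z := by
  ext j
  exact stat_sum Rb π hπstat (fun i => z (i, j))

lemma dev_Rop {n p : ℕ} (Rb : Matrix (Fin n) (Fin n) ℝ) (hrow : ∀ i, ∑ j, Rb i j = 1)
    (π : Fin n → ℝ)
    (hπstat : Matrix.vecMul π Rb = π) (z : Fin n × Fin p → ℝ) :
    dev π (Rop Rb z) = Rop Rb (dev π z) := by
  ext q
  simp only [dev, mn_Rop Rb π hπstat]
  simp only [Rop, dev, mul_sub, Finset.sum_sub_distrib, ← Finset.sum_mul, hrow, one_mul]

lemma sub_Rop {n p : ℕ} (Rb : Matrix (Fin n) (Fin n) ℝ) (hrow : ∀ i, ∑ j, Rb i j = 1)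
    (π : Fin n → ℝ) (z : Fin n × Fin p → ℝ) :
    z - Rop Rb z = dev π z - Rop Rb (dev π z) := by
  ext q
  simp only [Pi.sub_apply, Rop, dev, mul_sub, Finset.sum_sub_distrib, ← Finset.sum_mul, hrow,
    one_mul]
  ring

lemma wN_Rop {n p : ℕ} (Rb : Matrix (Fin n) (Fin n) ℝ) (π : Fin n → ℝ) (hπpos : ∀ i, 0 < π i)
    (s : ℝ) (hs : 0 ≤ s)
    (h : ∀ z : Fin n → ℝ, ∑ i, π i * z i = 0 →
      ∑ i, π i * (∑ j, Rb i j * z j) ^ 2 ≤ s ^ 2 * ∑ i, π i * z i ^ 2)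
    (z : Fin n × Fin p → ℝ) (hz : mn π z = 0) : wN π (Rop Rb z) ≤ s * wN π z := by
  have hnn : 0 ≤ ∑ q : Fin n × Fin p, π q.1 * z q ^ 2 :=
    Finset.sum_nonneg fun q _ => mul_nonneg (hπpos _).le (sq_nonneg _)
  rw [wN, Real.sqrt_le_iff]
  refine ⟨mul_nonneg hs (wN_nonneg _ _), ?_⟩
  rw [mul_pow, wN, Real.sq_sqrt hnn, Fintype.sum_prod_type_right, Fintype.sum_prod_type_right,
    Finset.mul_sum]
  refine Finset.sum_le_sum fun j _ => ?_
  exact h (fun i => z (i, j)) (congrFun hz j)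

lemma diag_conv {n : ℕ} (Rb : Matrix (Fin n) (Fin n) ℝ)
    (hnonneg : ∀ i j, 0 ≤ Rb i j) (hrow : ∀ i, ∑ j, Rb i j = 1)
    (hdiag : ∀ i, 0 < Rb i i)
    (π : Fin n → ℝ) (hπpos : ∀ i, 0 < π i) (hπsum : ∑ i, π i = 1)
    (hπstat : Matrix.vecMul π Rb = π) (s : ℝ) (hs : 0 ≤ s) (hs1 : s < 1)
    (h : ∀ z : Fin n → ℝ, ∑ i, π i * z i = 0 →
      ∑ i, π i * (∑ j, Rb i j * z j) ^ 2 ≤ s ^ 2 * ∑ i, π i * z i ^ 2) :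
    ∃ C : ℝ, 0 < C ∧ ∀ k i, |((Rb ^ k) i i)⁻¹ - (π i)⁻¹| ≤ C * s ^ k := by
  suffices hi : ∀ i, ∃ C : ℝ, 0 ≤ C ∧ ∀ k, |((Rb ^ k) i i)⁻¹ - (π i)⁻¹| ≤ C * s ^ k by
    choose C hC0 hC using hi
    have hS : 0 ≤ ∑ i, C i := Finset.sum_nonneg fun i _ => hC0 i
    refine ⟨∑ i, C i + 1, by linarith, fun k i => (hC i k).trans ?_⟩
    have : C i ≤ ∑ i, C i := Finset.single_le_sum (fun i _ => hC0 i) (Finset.mem_univ i)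
    exact mul_le_mul_of_nonneg_right (by linarith) (pow_nonneg hs k)
  intro i
  have hrowk : ∀ k, (Rb ^ k).mulVec (fun _ => (1 : ℝ)) = fun _ => 1 := by
    intro k
    induction k with
    | zero => simp
    | succ k ih =>
      rw [pow_succ, ← Matrix.mulVec_mulVec]
      have : Rb.mulVec (fun _ => (1 : ℝ)) = fun _ => 1 := by
        ext l; simp [Matrix.mulVec, dotProduct, hrow]
      rw [this, ih]
  obtain ⟨z, hzdef⟩ : ∃ z : Fin n → ℝ, z = Pi.single i 1 - π i • (fun _ => (1 : ℝ)) := ⟨_, rfl⟩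
  have hz0 : ∑ l, π l * z l = 0 := by
    simp [hzdef, mul_sub, Finset.sum_sub_distrib, ← Finset.sum_mul, hπsum, Pi.single_apply]
  have hiter : ∀ k, ∑ l, π l * ((Rb ^ k).mulVec z) l = 0 ∧
      ∑ l, π l * ((Rb ^ k).mulVec z) l ^ 2 ≤ (s ^ k) ^ 2 * ∑ l, π l * z l ^ 2 := by
    intro k
    induction k with
    | zero => simp [hz0]
    | succ k ih =>
      have e : (Rb ^ (k + 1)).mulVec z = fun l => ∑ j, Rb l j * ((Rb ^ k).mulVec z) j := by
        rw [pow_succ', ← Matrix.mulVec_mulVec]; ext l; simp [Matrix.mulVec, dotProduct]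
      rw [e]
      refine ⟨by rw [stat_sum Rb π hπstat]; exact ih.1, (h _ ih.1).trans ?_⟩
      calc _ ≤ s ^ 2 * ((s ^ k) ^ 2 * ∑ l, π l * z l ^ 2) :=
            mul_le_mul_of_nonneg_left ih.2 (sq_nonneg s)
        _ = _ := by ring
  have hval : ∀ k, ((Rb ^ k).mulVec z) i = (Rb ^ k) i i - π i := by
    intro k
    rw [hzdef, Matrix.mulVec_sub, Matrix.mulVec_smul, hrowk]
    simp
  obtain ⟨B, hB⟩ : ∃ B, B = (∑ l, π l * z l ^ 2) / π i := ⟨_, rfl⟩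
  have hB0 : 0 ≤ B := by
    rw [hB]; exact div_nonneg (Finset.sum_nonneg fun l _ =>
      mul_nonneg (hπpos l).le (sq_nonneg _)) (hπpos i).le
  have hd : ∀ k, |(Rb ^ k) i i - π i| ≤ Real.sqrt B * s ^ k := by
    intro k
    apply abs_le_of_sq_le_sq _ (by positivity)
    rw [mul_pow, Real.sq_sqrt hB0, hB, ← hval, div_mul_eq_mul_div, le_div_iff₀ (hπpos i)]
    have h1 := (hiter k).2
    have h2 : π i * ((Rb ^ k).mulVec z) i ^ 2 ≤ ∑ l, π l * ((Rb ^ k).mulVec z) l ^ 2 :=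
      Finset.single_le_sum (f := fun l => π l * ((Rb ^ k).mulVec z) l ^ 2)
        (fun l _ => mul_nonneg (hπpos l).le (sq_nonneg _)) (Finset.mem_univ i)
    linarith
  have ht : Tendsto (fun k : ℕ => (Rb ^ k) i i) atTop (nhds (π i)) := by
    rw [tendsto_iff_norm_sub_tendsto_zero]
    refine squeeze_zero (fun k => norm_nonneg _) hd ?_
    simpa using (tendsto_pow_atTop_nhds_zero_of_lt_one hs hs1).const_mul (Real.sqrt B)
  obtain ⟨D, hD⟩ := (ht.inv₀ (hπpos i).ne').bddAbove_range
  have hD' : ∀ k, ((Rb ^ k) i i)⁻¹ ≤ D := fun k => hD ⟨k, rfl⟩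
  have hD0 : 0 ≤ D := le_trans (inv_pos.2 (pow_diag_pos Rb hnonneg hdiag 0 i)).le (hD' 0)
  refine ⟨D * (π i)⁻¹ * Real.sqrt B, mul_nonneg (mul_nonneg hD0 (inv_pos.2 (hπpos i)).le)
    (Real.sqrt_nonneg _), fun k => ?_⟩
  have hp := pow_diag_pos Rb hnonneg hdiag k i
  rw [inv_sub_inv hp.ne' (hπpos i).ne', abs_div, abs_of_pos (mul_pos hp (hπpos i)),
    div_eq_mul_inv, mul_inv, abs_sub_comm]
  calc _ ≤ (Real.sqrt B * s ^ k) * (D * (π i)⁻¹) := by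
        have := hπpos i
        gcongr
        · exact hd k
        · exact hD' k
    _ = _ := by ring

/-! ### Gradient estimates -/

lemma sc_mono {p : ℕ} (f : (Fin p → ℝ) → ℝ) (g : (Fin p → ℝ) → Fin p → ℝ) (μ : ℝ)
    (hsc : ∀ x x', f x + (∑ j, g x j * (x' j - x j)) + μ / 2 * eucNorm (x' - x) ^ 2 ≤ f x')
    (x x' : Fin p → ℝ) :
    μ * eucNorm (x' - x) ^ 2 ≤ ∑ j, (x' j - x j) * (g x' j - g x j) := by
  have h1 := hsc x x'
  have h2 := hsc x' x
  have h3 : eucNorm (x - x') ^ 2 = eucNorm (x' - x) ^ 2 := by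
    rw [eucNorm_sq, eucNorm_sq]
    exact Finset.sum_congr rfl fun j _ => by simp only [Pi.sub_apply]; ring
  have h4 : ∑ j, (x' j - x j) * (g x' j - g x j)
      = - (∑ j, g x j * (x' j - x j)) - ∑ j, g x' j * (x j - x' j) := by
    rw [← Finset.sum_neg_distrib, ← Finset.sum_sub_distrib]
    exact Finset.sum_congr rfl fun j _ => by ring
  rw [h4]
  rw [h3] at h2
  linarith

lemma grad_zero {n p : ℕ} (f : Fin n → (Fin p → ℝ) → ℝ) (g : Fin n → (Fin p → ℝ) → Fin p → ℝ)
    (hgrad : ∀ i, IsGradient (f i) (g i)) (xstar : Fin p → ℝ)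
    (hmin : ∀ w, ∑ i, f i xstar ≤ ∑ i, f i w) (j : Fin p) : ∑ i, g i xstar j = 0 := by
  have h1 : HasFDerivAt (fun w => ∑ i, f i w)
      (∑ i, ∑ j, g i xstar j • (ContinuousLinearMap.proj j : (Fin p → ℝ) →L[ℝ] ℝ)) xstar :=
    HasFDerivAt.fun_sum fun i _ => hgrad i xstar
  have h2 : IsLocalMin (fun w => ∑ i, f i w) xstar := Filter.Eventually.of_forall hmin
  have h3 := h2.hasFDerivAt_eq_zero h1
  have h4 := congrArg (fun T : (Fin p → ℝ) →L[ℝ] ℝ => T (Pi.single j 1)) h3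
  simpa [_root_.sum_apply, Pi.single_apply] using h4

lemma gd_contr {n p : ℕ} (hn : 1 ≤ n)
    (f : Fin n → (Fin p → ℝ) → ℝ) (g : Fin n → (Fin p → ℝ) → Fin p → ℝ)
    (μ L : ℝ) (hμ : 0 < μ) (hμL : μ ≤ L)
    (hLip : ∀ i x x', eucNorm (g i x - g i x') ≤ L * eucNorm (x - x'))
    (hsc : ∀ i x x',
      f i x + (∑ j, g i x j * (x' j - x j)) + μ / 2 * eucNorm (x' - x) ^ 2 ≤ f i x')
    (xs v : Fin p → ℝ) (α : ℝ) (hα : 0 < α) (hα1 : α * n * L ^ 2 ≤ μ) :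
    eucNorm ((v - xs) - α • ∑ i, (g i v - g i xs)) ≤ (1 - α * (n * μ / 2)) * eucNorm (v - xs) := by
  have hn' : (1 : ℝ) ≤ n := by exact_mod_cast hn
  have hL : 0 < L := by linarith
  obtain ⟨Δ, hΔ⟩ : ∃ Δ, Δ = ∑ i, (g i v - g i xs) := ⟨_, rfl⟩
  obtain ⟨E, hE⟩ : ∃ E, E = eucNorm (v - xs) := ⟨_, rfl⟩
  have hE0 : 0 ≤ E := by rw [hE]; exact eucNorm_nonneg _
  have h1 : eucNorm Δ ≤ n * L * E := by
    rw [hΔ]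
    refine (eucNorm_sum _ _).trans ((Finset.sum_le_sum fun i _ => hLip i v xs).trans ?_)
    simp [hE, mul_assoc]
  have h2 : n * μ * E ^ 2 ≤ ∑ j, (v j - xs j) * Δ j := by
    have h3 : ∑ j, (v j - xs j) * Δ j = ∑ i, ∑ j, (v j - xs j) * (g i v j - g i xs j) := by
      rw [Finset.sum_comm]
      refine Finset.sum_congr rfl fun j _ => ?_
      rw [hΔ, Finset.sum_apply, Finset.mul_sum]
      rfl
    rw [h3]
    refine le_trans ?_ (Finset.sum_le_sum fun i _ => sc_mono (f i) (g i) μ (hsc i) xs v)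
    simp [hE, mul_assoc]
  have h3 : eucNorm ((v - xs) - α • Δ) ^ 2
      = E ^ 2 - 2 * α * (∑ j, (v j - xs j) * Δ j) + α ^ 2 * eucNorm Δ ^ 2 := by
    rw [hE, eucNorm_sq, eucNorm_sq, eucNorm_sq, Finset.mul_sum, Finset.mul_sum,
      ← Finset.sum_sub_distrib, ← Finset.sum_add_distrib]
    refine Finset.sum_congr rfl fun j _ => ?_
    simp only [Pi.sub_apply, Pi.smul_apply, smul_eq_mul]; ring
  have h4 : eucNorm Δ ^ 2 ≤ (n * L * E) ^ 2 := pow_le_pow_left₀ (eucNorm_nonneg _) h1 2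
  have h5 : α * n * μ ≤ 1 := by
    have a1 : α * n * L * L ≤ L := by nlinarith
    have a2 : α * n * L ≤ 1 := by
      by_contra hc
      push Not at hc
      nlinarith
    have a3 : α * n * μ ≤ α * n * L := mul_le_mul_of_nonneg_left hμL (by positivity)
    linarith
  rw [← hΔ, ← hE]
  apply le_of_sq_le_sq _ (mul_nonneg (by nlinarith) hE0)
  rw [h3]
  have h6 : α ^ 2 * eucNorm Δ ^ 2 ≤ α * n * μ * E ^ 2 := by
    calc _ ≤ α ^ 2 * (n * L * E) ^ 2 := mul_le_mul_of_nonneg_left h4 (sq_nonneg α)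
      _ = (α * n * L ^ 2) * (α * n * E ^ 2) := by ring
      _ ≤ μ * (α * n * E ^ 2) := mul_le_mul_of_nonneg_right hα1 (by positivity)
      _ = _ := by ring
  have h7 := mul_le_mul_of_nonneg_left h2 (by positivity : 0 ≤ 2 * α)
  have h8 : 0 ≤ (α * (n * μ / 2)) ^ 2 * E ^ 2 := by positivity
  nlinarith

/-- scaled gradient -/
noncomputable def scg {n p : ℕ} (g : Fin n → (Fin p → ℝ) → Fin p → ℝ) (d : Fin n → ℝ)
    (x : Fin n × Fin p → ℝ) : Fin n × Fin p → ℝ := fun q => d q.1 * gradf g x q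

lemma Vt_mulVec {n p : ℕ} (Rb : Matrix (Fin n) (Fin n) ℝ) (k : ℕ)
    (g : Fin n → (Fin p → ℝ) → Fin p → ℝ) (x : Fin n × Fin p → ℝ) :
    (VtinvK n p Rb k).mulVec (gradf g x) = scg g (fun i => ((Rb ^ k) i i)⁻¹) x := by
  ext q
  simp [VtinvK, Matrix.mulVec_diagonal, scg]

lemma blk_dist {n p : ℕ} (π : Fin n → ℝ) (c1 : ℝ)
    (hc1 : ∀ z : Fin n × Fin p → ℝ, eucNorm z ≤ c1 * wN π z)
    (x : Fin n × Fin p → ℝ) (i : Fin n) : eucNorm (blk x i - mn π x) ≤ c1 * wN π (dev π x) := by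
  have : blk x i - mn π x = blk (dev π x) i := by ext j; simp [blk, dev]
  rw [this]
  exact (blk_le _ i).trans (hc1 _)

lemma blk_dist' {n p : ℕ} (π : Fin n → ℝ) (c1 : ℝ)
    (hc1 : ∀ z : Fin n × Fin p → ℝ, eucNorm z ≤ c1 * wN π z)
    (xs : Fin p → ℝ) (x : Fin n × Fin p → ℝ) (i : Fin n) :
    eucNorm (blk x i - xs) ≤ c1 * wN π (dev π x) + eucNorm (mn π x - xs) := by
  have : blk x i - xs = (blk x i - mn π x) + (mn π x - xs) := by ring
  rw [this]
  exact (eucNorm_add _ _).trans (by gcongr; exact blk_dist π c1 hc1 x i)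

lemma H_bound {n p : ℕ} (π : Fin n → ℝ) (hπ : ∀ i, 0 < π i) (hπ1 : ∀ i, π i ≤ 1)
    (g : Fin n → (Fin p → ℝ) → Fin p → ℝ) (L : ℝ) (hL : 0 < L)
    (hLip : ∀ i x x', eucNorm (g i x - g i x') ≤ L * eucNorm (x - x'))
    (xs : Fin p → ℝ) (Cd : ℝ) :
    ∃ K : ℝ, 0 < K ∧ ∀ (d : Fin n → ℝ) (ε : ℝ) (x : Fin n × Fin p → ℝ),
      (∀ i, |d i - (π i)⁻¹| ≤ ε) → 0 ≤ ε → ε ≤ Cd →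
      wN π (dev π (scg g d x - scg g (fun i => (π i)⁻¹) (starVec n p xs)))
        ≤ K * (wN π (dev π x) + eucNorm (mn π x - xs)) + K * ε := by
  obtain ⟨c1, hc10, hc1⟩ := le_wN p π hπ
  obtain ⟨D, hD⟩ : ∃ D, D = |Cd| + ∑ i, (π i)⁻¹ := ⟨_, rfl⟩
  obtain ⟨Γ, hΓ⟩ : ∃ Γ, Γ = ∑ i, eucNorm (g i xs) := ⟨_, rfl⟩
  have hΓ0 : 0 ≤ Γ := by rw [hΓ]; exact Finset.sum_nonneg fun i _ => eucNorm_nonneg _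
  have hD0 : 0 ≤ D := by
    rw [hD]; exact add_nonneg (abs_nonneg _) (Finset.sum_nonneg fun i _ => (inv_pos.2 (hπ i)).le)
  obtain ⟨K, hK⟩ : ∃ K : ℝ, K = (1 + n) * (n * (D * L * (c1 + 1) + Γ)) + 1 := ⟨_, rfl⟩
  refine ⟨K, by rw [hK]; positivity, ?_⟩
  intro d ε x hd hε0 hε
  obtain ⟨e, he⟩ : ∃ e, e = wN π (dev π x) := ⟨_, rfl⟩
  obtain ⟨a, ha⟩ : ∃ a, a = eucNorm (mn π x - xs) := ⟨_, rfl⟩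
  have he0 : 0 ≤ e := by rw [he]; exact wN_nonneg _ _
  have ha0 : 0 ≤ a := by rw [ha]; exact eucNorm_nonneg _
  refine (dev_le π hπ hπ1 _).trans ?_
  rw [← he, ← ha]
  have key : ∀ i, eucNorm (blk (scg g d x - scg g (fun i => (π i)⁻¹) (starVec n p xs)) i)
      ≤ (D * L * (c1 + 1) + Γ) * (e + a) + (D * L * (c1 + 1) + Γ) * ε := by
    intro i
    have h1 : blk (scg g d x - scg g (fun i => (π i)⁻¹) (starVec n p xs)) i
        = d i • (g i (blk x i) - g i xs) + (d i - (π i)⁻¹) • g i xs := by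
      ext j
      simp only [blk, scg, gradf, starVec, Pi.sub_apply, Pi.add_apply, Pi.smul_apply, smul_eq_mul]
      change d i * g i (blk x i) j - (π i)⁻¹ * g i xs j = _
      ring
    rw [h1]
    refine (eucNorm_add _ _).trans ?_
    rw [eucNorm_smul, eucNorm_smul]
    have hdi : |d i| ≤ D := by
      have h2 : |d i| ≤ |d i - (π i)⁻¹| + |(π i)⁻¹| := by
        simpa using abs_add_le (d i - (π i)⁻¹) ((π i)⁻¹)
      have h3 : |(π i)⁻¹| ≤ ∑ i, (π i)⁻¹ := by
        rw [abs_of_pos (inv_pos.2 (hπ i))]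
        exact Finset.single_le_sum (f := fun i => (π i)⁻¹) (fun i _ => (inv_pos.2 (hπ i)).le)
          (Finset.mem_univ _)
      rw [hD]; linarith [hd i, le_abs_self Cd]
    have hgi : eucNorm (g i xs) ≤ Γ := by
      rw [hΓ]
      exact Finset.single_le_sum (f := fun i => eucNorm (g i xs)) (fun i _ => eucNorm_nonneg _)
        (Finset.mem_univ _)
    have hb : eucNorm (g i (blk x i) - g i xs) ≤ L * (c1 * e + a) :=
      (hLip i _ _).trans (mul_le_mul_of_nonneg_left
        (by rw [he, ha]; exact blk_dist' π c1 hc1 xs x i) hL.le)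
    have t1 : |d i| * eucNorm (g i (blk x i) - g i xs) ≤ D * (L * (c1 * e + a)) :=
      mul_le_mul hdi hb (eucNorm_nonneg _) hD0
    have t2 : |d i - (π i)⁻¹| * eucNorm (g i xs) ≤ ε * Γ :=
      mul_le_mul (hd i) hgi (eucNorm_nonneg _) hε0
    have t3 : 0 ≤ D * L * (e + c1 * a) + Γ * (e + a) + D * L * (c1 + 1) * ε := by positivity
    nlinarith
  refine (mul_le_mul_of_nonneg_left (Finset.sum_le_sum fun i _ => key i) (by positivity)).trans ?_
  simp only [Finset.sum_const, Finset.card_univ, Fintype.card_fin, nsmul_eq_mul]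
  rw [hK]
  nlinarith

lemma E_bound {n p : ℕ} (π : Fin n → ℝ) (hπ : ∀ i, 0 < π i) (hπ1 : ∀ i, π i ≤ 1)
    (g : Fin n → (Fin p → ℝ) → Fin p → ℝ) (L : ℝ) (hL : 0 < L)
    (hLip : ∀ i x x', eucNorm (g i x - g i x') ≤ L * eucNorm (x - x'))
    (xs : Fin p → ℝ) (hxs : ∀ j, ∑ i, g i xs j = 0) :
    ∃ K : ℝ, 0 < K ∧ ∀ (d : Fin n → ℝ) (ε : ℝ) (x : Fin n × Fin p → ℝ),
      (∀ i, |d i - (π i)⁻¹| ≤ ε) → 0 ≤ ε →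
      eucNorm (mn π (scg g d x) - ∑ i, (g i (mn π x) - g i xs))
        ≤ K * wN π (dev π x) + K * ε * (1 + wN π (dev π x) + eucNorm (mn π x - xs)) := by
  obtain ⟨c1, hc10, hc1⟩ := le_wN p π hπ
  obtain ⟨Γ, hΓ⟩ : ∃ Γ, Γ = ∑ i, eucNorm (g i xs) := ⟨_, rfl⟩
  have hΓ0 : 0 ≤ Γ := by rw [hΓ]; exact Finset.sum_nonneg fun i _ => eucNorm_nonneg _
  obtain ⟨K, hK⟩ : ∃ K : ℝ, K = n * (L * (c1 + 1) + Γ) + 1 := ⟨_, rfl⟩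
  refine ⟨K, by rw [hK]; positivity, ?_⟩
  intro d ε x hd hε0
  obtain ⟨e, he⟩ : ∃ e, e = wN π (dev π x) := ⟨_, rfl⟩
  obtain ⟨a, ha⟩ : ∃ a, a = eucNorm (mn π x - xs) := ⟨_, rfl⟩
  have he0 : 0 ≤ e := by rw [he]; exact wN_nonneg _ _
  have ha0 : 0 ≤ a := by rw [ha]; exact eucNorm_nonneg _
  rw [← he, ← ha]
  have h1 : mn π (scg g d x) - ∑ i, (g i (mn π x) - g i xs)
      = ∑ i, ((g i (blk x i) - g i (mn π x)) + (π i * (d i - (π i)⁻¹)) • g i (blk x i)) := by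
    ext j
    have h2 : mn π (scg g d x) j = ∑ i, π i * (d i * g i (blk x i) j) := rfl
    simp only [Pi.sub_apply, Finset.sum_apply, Pi.add_apply, Pi.smul_apply, smul_eq_mul]
    rw [h2, Finset.sum_sub_distrib, hxs j, sub_zero, ← Finset.sum_sub_distrib]
    refine Finset.sum_congr rfl fun i _ => ?_
    have := mul_inv_cancel₀ (hπ i).ne'
    linear_combination (g i (blk x i) j) * this
  rw [h1]
  refine (eucNorm_sum _ _).trans ?_
  have key : ∀ i, eucNorm ((g i (blk x i) - g i (mn π x))
      + (π i * (d i - (π i)⁻¹)) • g i (blk x i))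
      ≤ (L * (c1 + 1) + Γ) * e + (L * (c1 + 1) + Γ) * ε * (1 + e + a) := by
    intro i
    refine (eucNorm_add _ _).trans ?_
    rw [eucNorm_smul]
    have t1 : eucNorm (g i (blk x i) - g i (mn π x)) ≤ L * (c1 * e) :=
      (hLip i _ _).trans (mul_le_mul_of_nonneg_left
        (by rw [he]; exact blk_dist π c1 hc1 x i) hL.le)
    have hgi : eucNorm (g i xs) ≤ Γ := by
      rw [hΓ]
      exact Finset.single_le_sum (f := fun i => eucNorm (g i xs)) (fun i _ => eucNorm_nonneg _)
        (Finset.mem_univ _)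
    have hb : eucNorm (g i (blk x i) - g i xs) ≤ L * (c1 * e + a) :=
      (hLip i _ _).trans (mul_le_mul_of_nonneg_left
        (by rw [he, ha]; exact blk_dist' π c1 hc1 xs x i) hL.le)
    have t2 : eucNorm (g i (blk x i)) ≤ L * (c1 * e + a) + Γ := by
      have : g i (blk x i) = (g i (blk x i) - g i xs) + g i xs := by ring
      rw [this]
      exact (eucNorm_add _ _).trans (add_le_add hb hgi)
    have t3 : |π i * (d i - (π i)⁻¹)| ≤ ε := by
      rw [abs_mul, abs_of_pos (hπ i)]
      nlinarith [hπ1 i, hd i, abs_nonneg (d i - (π i)⁻¹), hπ i]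
    have t4 : |π i * (d i - (π i)⁻¹)| * eucNorm (g i (blk x i)) ≤ ε * (L * (c1 * e + a) + Γ) :=
      mul_le_mul t3 t2 (eucNorm_nonneg _) hε0
    have t5 : 0 ≤ L * e + Γ * e := by positivity
    have t6 : 0 ≤ ε * (L * (c1 + 1) + L * e + L * c1 * a + Γ * (e + a)) := by positivity
    nlinarith
  refine (Finset.sum_le_sum fun i _ => key i).trans ?_
  simp only [Finset.sum_const, Finset.card_univ, Fintype.card_fin, nsmul_eq_mul]
  rw [hK]
  have : 0 ≤ e + ε * (1 + e + a) := by positivity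
  nlinarith

set_option maxHeartbeats 2000000 in
/-- Theorem 2: for every `β > 0` there is `ᾱ > 0` such that for every
step size `0 < α < ᾱ` with `αβ < 1` and every initialization, the FRSD iterates converge
linearly to `1_n ⊗ x*`. -/
theorem stmt18 (n p : ℕ) (hn : 1 ≤ n) (hp : 1 ≤ p) (Rb : Matrix (Fin n) (Fin n) ℝ)
    (hnonneg : ∀ i j, 0 ≤ Rb i j) (hrow : ∀ i, ∑ j, Rb i j = 1)
    (hdiag : ∀ i, 0 < Rb i i)
    (hirr : ∀ i j, ∃ k : ℕ, 0 < (Rb ^ k) i j)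
    (π : Fin n → ℝ) (hπpos : ∀ i, 0 < π i) (hπsum : ∑ i, π i = 1)
    (hπstat : Matrix.vecMul π Rb = π)
    (f : Fin n → (Fin p → ℝ) → ℝ) (g : Fin n → (Fin p → ℝ) → Fin p → ℝ)
    (μ L : ℝ) (hμ : 0 < μ) (hμL : μ ≤ L)
    (hgrad : ∀ i, IsGradient (f i) (g i))
    (hLip : ∀ i x x', eucNorm (g i x - g i x') ≤ L * eucNorm (x - x'))
    (hsc : ∀ i x x',
      f i x + (∑ j, g i x j * (x' j - x j)) + μ / 2 * eucNorm (x' - x) ^ 2 ≤ f i x')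
    (xstar : Fin p → ℝ)
    (hmin : ∀ w, ∑ i, f i xstar ≤ ∑ i, f i w)
    (huniq : ∀ w, (∀ w', ∑ i, f i w ≤ ∑ i, f i w') → w = xstar)
    :
    ∀ β : ℝ, 0 < β → ∃ αbar : ℝ, 0 < αbar ∧
      ∀ α : ℝ, 0 < α → α < αbar → α * β < 1 →
        ∀ x y : ℕ → (Fin n × Fin p → ℝ), y 0 = 0 →
          (∀ k, x (k + 1) =
            (RK n p Rb).mulVec (x k)
              - α • (y k + (VtinvK n p Rb k).mulVec (gradf g (x k)))) →
          (∀ k, y (k + 1) = y k + β • ((1 - RK n p Rb).mulVec (x (k + 1)))) →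
          ∃ c : ℝ, 0 < c ∧ ∃ lam : ℝ, 0 < lam ∧ lam < 1 ∧
            ∀ k : ℕ, eucNorm (x k - starVec n p xstar) ≤ c * lam ^ k := by
  intro β hβ
  have hL : 0 < L := by linarith
  have hn' : (1 : ℝ) ≤ n := by exact_mod_cast hn
  have hπ1 : ∀ i, π i ≤ 1 := fun i => by
    rw [← hπsum]
    exact Finset.single_le_sum (fun i _ => (hπpos i).le) (Finset.mem_univ i)
  obtain ⟨s, hs0, hs1, hs⟩ := contr Rb hnonneg hrow hdiag hirr π hπpos hπsum hπstat
  obtain ⟨Cd, hCd0, hCd⟩ :=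
    diag_conv Rb hnonneg hrow hdiag π hπpos hπsum hπstat s hs0 hs1 hs
  have hgz := grad_zero f g hgrad xstar hmin
  obtain ⟨K1, hK10, hK1⟩ := H_bound π hπpos hπ1 g L hL hLip xstar Cd
  obtain ⟨K2, hK20, hK2⟩ := E_bound π hπpos hπ1 g L hL hLip xstar hgz
  obtain ⟨c1, hc10, hc1⟩ := le_wN p π hπpos
  obtain ⟨C, hC⟩ : ∃ C : ℝ, C = (1 + β + K1 + β ^ 2 + β * K1 + K2) + (K1 * Cd + K2 * Cd) :=
    ⟨_, rfl⟩
  have q1 := mul_pos hβ hK10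
  have q2 := mul_pos hK10 hCd0
  have q3 := mul_pos hK20 hCd0
  have q4 := pow_pos hβ 2
  obtain ⟨α0, hα00, hα0⟩ := frsd_lyap β s (n * μ / 2) C s hβ hs0 hs1 (by positivity)
    (by rw [hC]; positivity) hs0 hs1
  refine ⟨min α0 (min 1 (μ / (n * L ^ 2))), by positivity, ?_⟩
  intro α hα hαb hαβ x y hy0 hx hy
  have hαα0 : α < α0 := lt_of_lt_of_le hαb (min_le_left _ _)
  have hα1 : α < 1 := lt_of_lt_of_le hαb ((min_le_right _ _).trans (min_le_left _ _))
  have hαL : α * n * L ^ 2 ≤ μ := by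
    have h1 : α < μ / (n * L ^ 2) :=
      lt_of_lt_of_le hαb ((min_le_right _ _).trans (min_le_right _ _))
    rw [lt_div_iff₀ (by positivity)] at h1
    linarith
  -- abbreviations
  obtain ⟨d, hd⟩ : ∃ d : ℕ → Fin n → ℝ, d = fun k i => ((Rb ^ k) i i)⁻¹ := ⟨_, rfl⟩
  obtain ⟨G, hG⟩ : ∃ G : ℕ → Fin n × Fin p → ℝ, G = fun k => scg g (d k) (x k) := ⟨_, rfl⟩
  obtain ⟨Gs, hGs⟩ : ∃ Gs : Fin n × Fin p → ℝ,
    Gs = scg g (fun i => (π i)⁻¹) (starVec n p xstar) := ⟨_, rfl⟩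
  obtain ⟨xt, hxt⟩ : ∃ xt : ℕ → Fin n × Fin p → ℝ, xt = fun k => dev π (x k) := ⟨_, rfl⟩
  obtain ⟨Rx, hRx⟩ : ∃ Rx : ℕ → Fin n × Fin p → ℝ, Rx = fun k => Rop Rb (xt k) := ⟨_, rfl⟩
  obtain ⟨wt, hwt⟩ : ∃ wt : ℕ → Fin n × Fin p → ℝ, wt = fun k => y k + β • Rx k + Gs := ⟨_, rfl⟩
  obtain ⟨H, hH⟩ : ∃ H : ℕ → Fin n × Fin p → ℝ, H = fun k => dev π (G k - Gs) := ⟨_, rfl⟩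
  have hx' : ∀ k, x (k + 1) = Rop Rb (x k) - α • (y k + G k) := by
    intro k
    rw [hx k, RK_mulVec, Vt_mulVec, hG, hd]
  have hy' : ∀ k, y (k + 1) = y k + β • (xt (k + 1) - Rx (k + 1)) := by
    intro k
    rw [hy k, Matrix.sub_mulVec, Matrix.one_mulVec, RK_mulVec, sub_Rop Rb hrow π, hRx, hxt]
  have hmRx : ∀ k, mn π (Rx k) = 0 := by
    intro k
    rw [hRx]; simp only []
    rw [mn_Rop Rb π hπstat, hxt]
    exact mn_dev π hπsum _
  have hmxt : ∀ k, mn π (xt k) = 0 := by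
    intro k; rw [hxt]; exact mn_dev π hπsum _
  have hmy : ∀ k, mn π (y k) = 0 := by
    intro k
    induction k with
    | zero => rw [hy0]; ext j; simp [mn]
    | succ k ih => rw [hy' k, mn_add, mn_smul, mn_sub, ih, hmxt, hmRx]; simp
  have hmGs : mn π Gs = 0 := by
    ext j
    have : mn π Gs j = ∑ i, π i * ((π i)⁻¹ * g i xstar j) := by rw [hGs]; rfl
    rw [this]
    simp only [mul_inv_cancel_left₀ (hπpos _).ne']
    simpa using hgz j
  have rx : ∀ k, xt (k + 1) = Rx k - α • (wt k - β • Rx k + H k) := by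
    intro k
    have h1 : xt (k + 1) = Rx k - α • (y k + dev π (G k)) := by
      rw [hxt, hRx]; simp only []
      rw [hx' k, dev_sub, dev_smul, dev_add, dev_Rop Rb hrow π hπstat, dev_self π _ (hmy k), hxt]
    have h2 : H k = dev π (G k) - Gs := by
      rw [hH]; simp only []
      rw [dev_sub, dev_self π _ hmGs]
    rw [h1, h2, hwt]
    congr 2
    ext q
    simp only [Pi.add_apply, Pi.sub_apply]
    ring
  have rw' : ∀ k, wt (k + 1) = wt k - (α * β) • (wt k - β • Rx k + H k) := by
    intro k
    have h1 : wt (k + 1) = y k + β • xt (k + 1) + Gs := by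
      rw [hwt]; simp only []
      rw [hy' k]
      ext q
      simp only [Pi.add_apply, Pi.sub_apply, Pi.smul_apply, smul_eq_mul]
      ring
    have h2 : y k = wt k - β • Rx k - Gs := by
      rw [hwt]; ext q
      simp only [Pi.add_apply, Pi.sub_apply, Pi.smul_apply, smul_eq_mul]
      ring
    rw [h1, h2, rx k]
    ext q
    simp only [Pi.add_apply, Pi.sub_apply, Pi.smul_apply, smul_eq_mul]
    ring
  have ra : ∀ k, mn π (x (k + 1)) = mn π (x k) - α • mn π (G k) := by
    intro k
    rw [hx' k, mn_sub, mn_smul, mn_add, mn_Rop Rb π hπstat, hmy k, zero_add]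
  have hpow : ∀ k : ℕ, 0 ≤ s ^ k := fun k => pow_nonneg hs0 k
  have hpow1 : ∀ k : ℕ, s ^ k ≤ 1 := fun k => pow_le_one₀ hs0 hs1.le
  have bH : ∀ k, wN π (H k) ≤ K1 * (wN π (xt k) + eucNorm (mn π (x k) - xstar))
      + K1 * (Cd * s ^ k) := by
    intro k
    have := hK1 (d k) (Cd * s ^ k) (x k) (by rw [hd]; exact hCd k)
      (mul_nonneg hCd0.le (hpow k)) (by nlinarith [hpow1 k])
    rw [hH, hG, hGs, hxt]
    exact this
  have bE : ∀ k, eucNorm (mn π (G k) - ∑ i, (g i (mn π (x k)) - g i xstar))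
      ≤ K2 * wN π (xt k) + K2 * (Cd * s ^ k)
        * (1 + wN π (xt k) + eucNorm (mn π (x k) - xstar)) := by
    intro k
    have := hK2 (d k) (Cd * s ^ k) (x k) (by rw [hd]; exact hCd k)
      (mul_nonneg hCd0.le (hpow k))
    rw [hG, hxt]
    exact this
  have bR : ∀ k, wN π (Rx k) ≤ s * wN π (xt k) := by
    intro k
    rw [hRx]
    exact wN_Rop Rb π hπpos s hs0 hs (xt k) (hmxt k)
  obtain ⟨c, hc0, lam, hl0, hl1, hfin⟩ := hα0 α hα hαα0 hαβ (fun k => wN π (xt k))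
    (fun k => wN π (wt k)) (fun k => eucNorm (mn π (x k) - xstar))
    (fun k => wN_nonneg _ _) (fun k => wN_nonneg _ _) (fun k => eucNorm_nonneg _)
    (by
      intro k
      have h1 : xt (k + 1) = (1 + α * β) • Rx k + ((-α) • wt k + (-α) • H k) := by
        rw [rx k]; ext q
        simp only [Pi.add_apply, Pi.sub_apply, Pi.smul_apply, smul_eq_mul]
        ring
      have h2 : wN π (xt (k + 1)) ≤ (1 + α * β) * wN π (Rx k) + (α * wN π (wt k) + α * wN π (H k)) := by
        rw [h1]
        refine (wN_add π hπpos _ _).trans ?_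
        refine add_le_add ?_ ((wN_add π hπpos _ _).trans ?_)
        · rw [wN_smul π hπpos, abs_of_pos (by positivity)]
        · rw [wN_smul π hπpos, wN_smul π hπpos, abs_neg, abs_of_pos hα]
      have b1 := bH k
      have b2 := bR k
      have e0 := wN_nonneg π (xt k)
      have w0 := wN_nonneg π (wt k)
      have a0 := eucNorm_nonneg (mn π (x k) - xstar)
      have p0 := hpow k
      generalize wN π (xt k) = e at *
      generalize wN π (wt k) = w at *
      generalize eucNorm (mn π (x k) - xstar) = a at *
      generalize s ^ k = P at *
      have m1 := mul_le_mul_of_nonneg_left b1 hα.le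
      have m2 := mul_le_mul_of_nonneg_left b2 (by positivity : 0 ≤ 1 + α * β)
      have m3 : α * β * (s * e) ≤ α * β * e :=
        mul_le_mul_of_nonneg_left (by nlinarith) (by positivity)
      have m4 : α * (K1 * (Cd * P)) ≤ 1 * (K1 * (Cd * P)) :=
        mul_le_mul_of_nonneg_right hα1.le (by positivity)
      have r1 : α * (β + K1) * e ≤ α * C * e := by
        gcongr; linarith
      have r2 : α * 1 * w ≤ α * C * w := by
        gcongr; linarith
      have r3 : α * K1 * a ≤ α * C * a := by
        gcongr; linarith
      have r4 : (K1 * Cd) * P * 1 ≤ C * P * (1 + e + a) := by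
        gcongr
        · rw [hC]; positivity
        · linarith
        · linarith
      nlinarith)
    (by
      intro k
      have h1 : wt (k + 1) = (1 - α * β) • wt k + ((α * β * β) • Rx k + (-(α * β)) • H k) := by
        rw [rw' k]; ext q
        simp only [Pi.add_apply, Pi.sub_apply, Pi.smul_apply, smul_eq_mul]
        ring
      have h2 : wN π (wt (k + 1)) ≤ (1 - α * β) * wN π (wt k)
          + (α * β * β * wN π (Rx k) + α * β * wN π (H k)) := by
        rw [h1]
        refine (wN_add π hπpos _ _).trans ?_
        refine add_le_add ?_ ((wN_add π hπpos _ _).trans ?_)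
        · rw [wN_smul π hπpos, abs_of_pos (by linarith)]
        · rw [wN_smul π hπpos, wN_smul π hπpos, abs_neg, abs_of_pos (by positivity),
            abs_of_pos (by positivity)]
      have b1 := bH k
      have b2 := bR k
      have e0 := wN_nonneg π (xt k)
      have w0 := wN_nonneg π (wt k)
      have a0 := eucNorm_nonneg (mn π (x k) - xstar)
      have p0 := hpow k
      generalize wN π (xt k) = e at *
      generalize wN π (wt k) = w at *
      generalize eucNorm (mn π (x k) - xstar) = a at *
      generalize s ^ k = P at *
      have m1 := mul_le_mul_of_nonneg_left b1 (by positivity : 0 ≤ α * β)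
      have m2 := mul_le_mul_of_nonneg_left b2 (by positivity : 0 ≤ α * β * β)
      have m3 : α * β * β * (s * e) ≤ α * β * β * e :=
        mul_le_mul_of_nonneg_left (by nlinarith) (by positivity)
      have m4 : α * β * (K1 * (Cd * P)) ≤ 1 * (K1 * (Cd * P)) :=
        mul_le_mul_of_nonneg_right hαβ.le (by positivity)
      have r1 : α * (β ^ 2 + β * K1) * e ≤ α * C * e := by
        gcongr; linarith
      have r3 : α * (β * K1) * a ≤ α * C * a := by
        gcongr; linarith
      have r4 : (K1 * Cd) * P * 1 ≤ C * P * (1 + e + a) := by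
        gcongr
        · rw [hC]; positivity
        · linarith
        · linarith
      nlinarith)
    (by
      intro k
      have h1 : mn π (x (k + 1)) - xstar
          = ((mn π (x k) - xstar) - α • ∑ i, (g i (mn π (x k)) - g i xstar))
            + (-α) • (mn π (G k) - ∑ i, (g i (mn π (x k)) - g i xstar)) := by
        rw [ra k]; ext q
        simp only [Pi.add_apply, Pi.sub_apply, Pi.smul_apply, smul_eq_mul]
        ring
      have h2 : eucNorm (mn π (x (k + 1)) - xstar)
          ≤ (1 - α * (n * μ / 2)) * eucNorm (mn π (x k) - xstar)
            + α * eucNorm (mn π (G k) - ∑ i, (g i (mn π (x k)) - g i xstar)) := by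
        rw [h1]
        refine (eucNorm_add _ _).trans (add_le_add
          (gd_contr hn f g μ L hμ hμL hLip hsc xstar (mn π (x k)) α hα hαL) ?_)
        rw [eucNorm_smul, abs_neg, abs_of_pos hα]
      have b1 := bE k
      have e0 := wN_nonneg π (xt k)
      have a0 := eucNorm_nonneg (mn π (x k) - xstar)
      have p0 := hpow k
      generalize wN π (xt k) = e at *
      generalize eucNorm (mn π (x k) - xstar) = a at *
      generalize s ^ k = P at *
      have m1 := mul_le_mul_of_nonneg_left b1 hα.le
      have m4 : α * (K2 * (Cd * P) * (1 + e + a)) ≤ 1 * (K2 * (Cd * P) * (1 + e + a)) :=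
        mul_le_mul_of_nonneg_right hα1.le (by positivity)
      have r1 : α * K2 * e ≤ α * C * e := by
        gcongr; linarith
      have r4 : (K2 * Cd) * P * (1 + e + a) ≤ C * P * (1 + e + a) := by
        gcongr
        linarith
      nlinarith)
  refine ⟨n * (c1 + 1) * c, by positivity, lam, hl0, hl1, fun k => ?_⟩
  have h1 : ∀ i, eucNorm (blk (x k - starVec n p xstar) i) ≤ (c1 + 1) * (c * lam ^ k) := by
    intro i
    have h2 : blk (x k - starVec n p xstar) i = blk (x k) i - xstar := by
      ext j; simp [blk, starVec]
    have h3 := blk_dist' π c1 hc1 xstar (x k) i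
    have h4 := hfin k
    rw [hxt] at h4
    simp only [] at h4
    rw [h2]
    have h5 := mul_le_mul_of_nonneg_left h4 (by positivity : 0 ≤ c1 + 1)
    nlinarith [wN_nonneg π (dev π (x k)), eucNorm_nonneg (mn π (x k) - xstar)]
  refine (le_blk _).trans ((Finset.sum_le_sum fun i _ => h1 i).trans ?_)
  simp only [Finset.sum_const, Finset.card_univ, Fintype.card_fin, nsmul_eq_mul]
  apply le_of_eq; ring
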